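/- Let k ≥ 11 be an integer, let s = ⌊k/4⌋, and let A_k be the alternating group of degree k. Then n(A_k) ≥ 2^{2s}/(2s + 1), and consequently n(A_k) > 2^{k/10}. -/

import Mathlib

/-!  Definition of the Noether number `β(G)` of a group `G`, over the field `ℂ`
(of characteristic 0).  A finite-dimensional `ℂG`-module is (up to isomorphism)
given by a representation `ρ : Representation ℂ G (Fin n → ℂ)`; the algebra of
polynomial invariants is realised inside `MvPolynomial (Fin n) ℂ` as the
common equalizer of the substitution maps induced by the group elements. -/

/-- The algebra endomorphism of the polynomial ring induced by the linear action of
`g : G` on the underlying space (substitution of the variables by linear forms). -/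
noncomputable def Representation.polySubst {G : Type*} [Group G] {n : ℕ}
    (ρ : Representation ℂ G (Fin n → ℂ)) (g : G) :
    MvPolynomial (Fin n) ℂ →ₐ[ℂ] MvPolynomial (Fin n) ℂ :=
  MvPolynomial.aeval fun i =>
    ∑ j, MvPolynomial.C (LinearMap.toMatrix' (ρ g) i j) * MvPolynomial.X j

/-- The subalgebra of `G`-invariant polynomials. -/
noncomputable def Representation.invariantAlgebra {G : Type*} [Group G] {n : ℕ}
    (ρ : Representation ℂ G (Fin n → ℂ)) : Subalgebra ℂ (MvPolynomial (Fin n) ℂ) :=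
  ⨅ g : G, AlgHom.equalizer (ρ.polySubst g) (AlgHom.id ℂ (MvPolynomial (Fin n) ℂ))

/-- The invariant algebra is generated by its elements of (total) degree at most `d`. -/
def Representation.InvariantsGeneratedInDegree {G : Type*} [Group G] {n : ℕ}
    (ρ : Representation ℂ G (Fin n → ℂ)) (d : ℕ) : Prop :=
  Algebra.adjoin ℂ {f : MvPolynomial (Fin n) ℂ | f ∈ ρ.invariantAlgebra ∧ f.totalDegree ≤ d}
    = ρ.invariantAlgebra

/-- The Noether number `β(G)`: the smallest degree bound `d` such that for every
finite-dimensional `ℂG`-module the algebra of polynomial invariants is generated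
by its elements of degree at most `d`.  (Equivalently, the maximum over all
finite-dimensional modules `V` of the minimal generating degree `β(G,V)`.) -/
noncomputable def noetherNumber (G : Type*) [Group G] : ℕ :=
  sInf {d : ℕ | ∀ (n : ℕ) (ρ : Representation ℂ G (Fin n → ℂ)),
    ρ.InvariantsGeneratedInDegree d}

/-- The Noether index `n(G) = |G| / β(G)`, as a real number. -/
noncomputable def noetherIndex (G : Type*) [Group G] : ℝ :=
  (Nat.card G : ℝ) / (noetherNumber G : ℝ)

open MvPolynomial in
theorem Representation.polySubst_X {G : Type*} [Group G] {n : ℕ}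
    (ρ : Representation ℂ G (Fin n → ℂ)) (g : G) (i : Fin n) :
    ρ.polySubst g (X i) = ∑ j, C (LinearMap.toMatrix' (ρ g) i j) * X j := by
  simp [Representation.polySubst]

/-- The left action of `G` on polynomials, by substitution along inverses. -/
noncomputable def Representation.polyAction {G : Type*} [Group G] {n : ℕ}
    (ρ : Representation ℂ G (Fin n → ℂ)) :
    G →* (MvPolynomial (Fin n) ℂ →ₐ[ℂ] MvPolynomial (Fin n) ℂ) where
  toFun g := ρ.polySubst g⁻¹
  map_one' := by
    ext i : 1
    rw [inv_one, ρ.polySubst_X, map_one]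
    have h : LinearMap.toMatrix' (1 : (Fin n → ℂ) →ₗ[ℂ] (Fin n → ℂ)) = 1 :=
      LinearMap.toMatrix'_one
    simp only [h, Matrix.one_apply]
    simp [apply_ite MvPolynomial.C, ite_mul]
  map_mul' g h := by
    ext i : 1
    have hm : LinearMap.toMatrix' (ρ (h⁻¹ * g⁻¹))
        = LinearMap.toMatrix' (ρ h⁻¹) * LinearMap.toMatrix' (ρ g⁻¹) := by
      rw [map_mul, LinearMap.toMatrix'_mul]
    rw [AlgHom.mul_apply, ρ.polySubst_X, ρ.polySubst_X, mul_inv_rev, hm]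
    simp only [Matrix.mul_apply, map_sum, map_mul, ρ.polySubst_X, MvPolynomial.algHom_C,
      MvPolynomial.algebraMap_eq, Finset.sum_mul, Finset.mul_sum, mul_assoc]
    exact Finset.sum_comm

theorem Representation.mem_invariantAlgebra_iff {G : Type*} [Group G] {n : ℕ}
    (ρ : Representation ℂ G (Fin n → ℂ)) (p : MvPolynomial (Fin n) ℂ) :
    p ∈ ρ.invariantAlgebra ↔ ∀ g, ρ.polyAction g p = p := by
  simp only [Representation.invariantAlgebra, Algebra.mem_iInf, AlgHom.mem_equalizer,
    AlgHom.id_apply]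
  exact ⟨fun h g => h g⁻¹, fun h g => by simpa [Representation.polyAction] using h g⁻¹⟩

theorem Representation.totalDegree_polyAction_le {G : Type*} [Group G] {n : ℕ}
    (ρ : Representation ℂ G (Fin n → ℂ)) (g : G) (p : MvPolynomial (Fin n) ℂ) :
    (ρ.polyAction g p).totalDegree ≤ p.totalDegree := by
  change (ρ.polySubst g⁻¹ p).totalDegree ≤ _
  have hX (i : Fin n) : (ρ.polySubst g⁻¹ (.X i)).totalDegree ≤ 1 := by
    rw [ρ.polySubst_X]
    refine MvPolynomial.totalDegree_finsetSum_le fun j _ => ?_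
    refine (MvPolynomial.totalDegree_mul _ _).trans ?_
    simp
  conv_lhs => rw [p.as_sum, map_sum]
  refine MvPolynomial.totalDegree_finsetSum_le fun a ha => ?_
  rw [MvPolynomial.monomial_eq, map_mul, Finsupp.prod, map_prod, MvPolynomial.algHom_C,
    MvPolynomial.algebraMap_eq]
  refine (MvPolynomial.totalDegree_mul _ _).trans ?_
  rw [MvPolynomial.totalDegree_C, zero_add]
  refine (MvPolynomial.totalDegree_finsetProd _ _).trans ?_
  refine le_trans (Finset.sum_le_sum fun i _ => ?_) (MvPolynomial.le_totalDegree ha)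
  rw [map_pow]
  exact (MvPolynomial.totalDegree_pow _ _).trans (by simpa using Nat.mul_le_mul_left (a i) (hX i))

section Transfer

variable {G A : Type*} [Group G] [Fintype G] [CommRing A] [Algebra ℂ A]

/-- The transfer map `a ↦ ∑ g, g • a` for an action by algebra endomorphisms. -/
noncomputable def actionTransfer (σ : G →* (A →ₐ[ℂ] A)) : A →ₗ[ℂ] A :=
  ∑ g, (σ g).toLinearMap

theorem actionTransfer_apply (σ : G →* (A →ₐ[ℂ] A)) (a : A) :
    actionTransfer σ a = ∑ g, σ g a := by
  simp [actionTransfer]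

theorem map_actionTransfer (σ : G →* (A →ₐ[ℂ] A)) (g : G) (a : A) :
    σ g (actionTransfer σ a) = actionTransfer σ a := by
  simp only [actionTransfer_apply, map_sum, ← AlgHom.mul_apply, ← map_mul]
  exact Equiv.sum_comp (Equiv.mulLeft g) fun x => σ x a

theorem actionTransfer_mul_of_invariant (σ : G →* (A →ₐ[ℂ] A)) (a : A) {q : A}
    (hq : ∀ g, σ g q = q) : actionTransfer σ (a * q) = actionTransfer σ a * q := by
  simp [actionTransfer_apply, hq, Finset.sum_mul]

theorem actionTransfer_of_invariant (σ : G →* (A →ₐ[ℂ] A)) {q : A}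
    (hq : ∀ g, σ g q = q) : actionTransfer σ q = (Fintype.card G : ℂ) • q := by
  simp [actionTransfer_apply, hq, Nat.cast_smul_eq_nsmul]

/-- The transfer of a product of `[G : H]` invariants of `H` and a further factor lies in every
subalgebra containing the transfers of the factors and of the proper partial products. -/
theorem actionTransfer_mul_prod_mem (σ : G →* (A →ₐ[ℂ] A)) (H : Subgroup G)
    [Fintype (G ⧸ H)] (B : Subalgebra ℂ A) (b : G ⧸ H → A) (c : A)
    (hb : ∀ i, ∀ h ∈ H, σ h (b i) = b i)
    (h₁ : ∀ S : Finset (G ⧸ H), actionTransfer σ (∏ i ∈ S, σ i.out (b i)) ∈ B)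
    (h₂ : ∀ S : Finset (G ⧸ H), S ≠ Finset.univ → actionTransfer σ (c * ∏ i ∈ S, b i) ∈ B) :
    actionTransfer σ (c * ∏ i, b i) ∈ B := by
  classical
  have hzero (g : G) : ∏ i : G ⧸ H, (σ g (b i) + -σ i.out (b i)) = 0 := by
    refine Finset.prod_eq_zero (Finset.mem_univ (g : G ⧸ H)) ?_
    obtain ⟨h, hh⟩ := QuotientGroup.mk_out_eq_mul H g
    rw [hh, map_mul, AlgHom.mul_apply, hb _ _ h.2, add_neg_cancel]
  have hsum : ∑ S : Finset (G ⧸ H),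
      actionTransfer σ (c * ∏ i ∈ S, b i) * ∏ i ∈ Sᶜ, -σ i.out (b i) = 0 := by
    simp only [actionTransfer_apply, Finset.sum_mul]
    rw [Finset.sum_comm]
    refine Finset.sum_eq_zero fun g _ => ?_
    have := hzero g
    rw [Finset.prod_add, Finset.powerset_univ] at this
    rw [← mul_zero (σ g c), ← this, Finset.mul_sum]
    refine Finset.sum_congr rfl fun S _ => ?_
    rw [map_mul, map_prod, ← Finset.compl_eq_univ_sdiff, mul_assoc]
  rw [← Finset.add_sum_erase _ _ (Finset.mem_univ Finset.univ)] at hsum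
  have hT := congrArg (actionTransfer σ) hsum
  simp only [Finset.compl_univ, Finset.prod_empty, mul_one, map_add, map_zero, map_sum] at hT
  rw [actionTransfer_of_invariant σ fun g => map_actionTransfer σ g _] at hT
  have hmem : (Fintype.card G : ℂ) • actionTransfer σ (c * ∏ i, b i) ∈ B := by
    rw [eq_neg_of_add_eq_zero_left hT]
    refine B.neg_mem (B.sum_mem fun S hS => ?_)
    rw [mul_comm, actionTransfer_mul_of_invariant σ _ fun g => map_actionTransfer σ g _]
    refine B.mul_mem ?_ (h₂ S (Finset.ne_of_mem_erase hS))
    rw [Finset.prod_neg, ← map_one (algebraMap ℂ A), ← map_neg, ← map_pow, ← Algebra.smul_def,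
      map_smul]
    exact B.smul_mem (h₁ _) _
  have hc : (Fintype.card G : ℂ) ≠ 0 := Nat.cast_ne_zero.mpr Fintype.card_ne_zero
  simpa [smul_smul, hc] using B.smul_mem hmem (Fintype.card G : ℂ)⁻¹

end Transfer

/-- In a group of exponent two and order at most `2 ^ r`, every family of more than `r` elements
has a nonempty subfamily of at most `r + 1` elements with product one. -/
theorem exists_prod_eq_one_of_mul_self {Ψ α : Type*} [CommGroup Ψ] [Fintype Ψ] [DecidableEq α]
    (hΨ : ∀ x : Ψ, x * x = 1) {r : ℕ} (hr : Fintype.card Ψ ≤ 2 ^ r) (f : α → Ψ) (U : Finset α)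
    (hU : r + 1 ≤ U.card) : ∃ J ⊆ U, J.Nonempty ∧ J.card ≤ r + 1 ∧ ∏ i ∈ J, f i = 1 := by
  obtain ⟨W, hWU, hW⟩ := Finset.exists_subset_card_eq hU
  obtain ⟨S, hS, S', hS', hne, heq⟩ := Finset.exists_ne_map_eq_of_card_lt_of_maps_to
    (s := W.powerset) (t := (Finset.univ : Finset Ψ)) (f := fun S => ∏ i ∈ S, f i)
    (by
      rw [Finset.card_powerset, hW, Finset.card_univ]
      exact hr.trans_lt (Nat.pow_lt_pow_right one_lt_two (Nat.lt_succ_self r)))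
    (fun _ _ => Finset.mem_coe.mpr (Finset.mem_univ _))
  rw [Finset.mem_powerset] at hS hS'
  have hJ : symmDiff S S' ⊆ W := by
    rw [symmDiff_def, Finset.sup_eq_union]
    exact Finset.union_subset (Finset.sdiff_subset.trans hS) (Finset.sdiff_subset.trans hS')
  refine ⟨symmDiff S S', hJ.trans hWU, Finset.symmDiff_nonempty.mpr hne,
    (Finset.card_le_card hJ).trans hW.le, ?_⟩
  rw [symmDiff_def, Finset.sup_eq_union, Finset.prod_union disjoint_sdiff_sdiff]
  have h1 := Finset.prod_inter_mul_prod_sdiff S S' f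
  have h2 := Finset.prod_inter_mul_prod_sdiff S' S f
  rw [Finset.inter_comm] at h2
  have h3 : ∏ i ∈ S \ S', f i = ∏ i ∈ S' \ S, f i :=
    mul_left_cancel ((h1.trans heq).trans h2.symm)
  rw [h3, hΨ]

/-- A long product of linear eigenvectors of an elementary abelian `2`-group splits off many
invariant factors of small degree. -/
theorem exists_invariant_factors {n : ℕ} {Ψ α ι E : Type*} [CommGroup Ψ] [Fintype Ψ]
    [DecidableEq α] [DecidableEq ι]
    (hΨ : ∀ x : Ψ, x * x = 1) {r : ℕ} (hr : Fintype.card Ψ ≤ 2 ^ r)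
    (τ : E → MvPolynomial (Fin n) ℂ →ₐ[ℂ] MvPolynomial (Fin n) ℂ)
    (ev : E → Ψ →* ℂ) (f : α → Ψ) (l : α → MvPolynomial (Fin n) ℂ)
    (hl : ∀ i, (l i).totalDegree ≤ 1) (hτ : ∀ v i, τ v (l i) = ev v (f i) • l i)
    (t : Finset ι) : ∀ U : Finset α, t.card * (r + 1) ≤ U.card →
    ∃ (b : ι → MvPolynomial (Fin n) ℂ) (c : MvPolynomial (Fin n) ℂ) (e : ι → ℕ) (e' : ℕ),
      (∀ i ∈ t, (∀ v, τ v (b i) = b i) ∧ (b i).totalDegree ≤ e i ∧ 1 ≤ e i ∧ e i ≤ r + 1) ∧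
      c.totalDegree ≤ e' ∧ ∑ i ∈ t, e i + e' = U.card ∧ ∏ i ∈ U, l i = c * ∏ i ∈ t, b i := by
  have hdeg (J : Finset α) : (∏ i ∈ J, l i).totalDegree ≤ J.card :=
    (MvPolynomial.totalDegree_finsetProd _ _).trans
      ((Finset.sum_le_sum fun i _ => hl i).trans (by simp))
  induction t using Finset.induction_on with
  | empty => exact fun U _ => ⟨1, ∏ i ∈ U, l i, 0, U.card, by simp, hdeg U, by simp, by simp⟩
  | insert a t ha ih =>
    intro U hU
    rw [Finset.card_insert_of_notMem ha, add_mul, one_mul] at hU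
    obtain ⟨J, hJU, hJ, hJr, hJ1⟩ := exists_prod_eq_one_of_mul_self hΨ hr f U (by omega)
    have hcard := Finset.card_sdiff_add_card_eq_card hJU
    obtain ⟨b, c, e, e', hb, hc, he, hp⟩ := ih (U \ J) (by omega)
    have hne {i : ι} (hi : i ∈ t) : i ≠ a := fun h => ha (h ▸ hi)
    refine ⟨Function.update b a (∏ i ∈ J, l i), c, Function.update e a J.card, e', ?_, hc, ?_, ?_⟩
    · intro i hi
      rcases Finset.mem_insert.mp hi with rfl | hi
      · simp only [Function.update_self]
        refine ⟨fun v => ?_, hdeg J, hJ.card_pos, hJr⟩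
        rw [map_prod]
        simp only [hτ]
        rw [Finset.prod_smul, ← map_prod, hJ1, map_one, one_smul]
      · simpa [Function.update_of_ne (hne hi)] using hb i hi
    · rw [Finset.sum_insert ha, Function.update_self,
        Finset.sum_congr rfl fun i hi => Function.update_of_ne (hne hi) _ _]
      omega
    · rw [Finset.prod_insert ha, Function.update_self,
        Finset.prod_congr rfl fun i hi => Function.update_of_ne (hne hi) _ _,
        ← Finset.prod_sdiff hJU, hp]
      ring

/-- Every polynomial of degree at most `D` lies in the `D`-th power of each subspace containing
`1` and the variables. -/
theorem MvPolynomial.mem_submodule_pow_of_totalDegree_le {n : ℕ}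
    (M : Submodule ℂ (MvPolynomial (Fin n) ℂ)) (h1 : 1 ∈ M) (hX : ∀ i, X i ∈ M) {D : ℕ}
    (p : MvPolynomial (Fin n) ℂ) (hp : p.totalDegree ≤ D) : p ∈ M ^ D := by
  have h1' : (1 : Submodule ℂ (MvPolynomial (Fin n) ℂ)) ≤ M := Submodule.one_le.mpr h1
  rw [p.as_sum]
  refine Submodule.sum_mem _ fun a ha => ?_
  rw [monomial_eq, ← smul_eq_C_mul]
  refine Submodule.smul_mem _ _ ?_
  have hle : a.sum (fun _ e => e) ≤ D := (le_totalDegree ha).trans hp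
  refine pow_le_pow_right₀ h1' hle ?_
  rw [Finsupp.sum, Finsupp.prod]
  induction a.support using Finset.induction_on with
  | empty => exact Submodule.one_le.mp (pow_zero M).ge
  | insert i s hi ih =>
    rw [Finset.prod_insert hi, Finset.sum_insert hi, pow_add]
    exact Submodule.mul_mem_mul (Submodule.pow_mem_pow _ (hX i) _) ih

/-- An action of a finite abelian group decomposes every vector into eigenvectors. -/
theorem mem_span_eigenvectors {E A : Type*} [AddCommGroup E] [Fintype E] [AddCommGroup A]
    [Module ℂ A] (τ : E → A →ₗ[ℂ] A) (h0 : τ 0 = LinearMap.id)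
    (hadd : ∀ v w a, τ (v + w) a = τ v (τ w a)) (W : Submodule ℂ A)
    (hW : ∀ v, ∀ a ∈ W, τ v a ∈ W) {a : A} (ha : a ∈ W) :
    a ∈ Submodule.span ℂ {x | x ∈ W ∧ ∃ ψ : AddChar E ℂ, ∀ v, τ v x = ψ v • x} := by
  classical
  let P (ψ : AddChar E ℂ) : A := ∑ v, ψ (-v) • τ v a
  have hP (ψ : AddChar E ℂ) : P ψ ∈ W ∧ ∃ χ : AddChar E ℂ, ∀ v, τ v (P ψ) = χ v • P ψ := by
    refine ⟨Submodule.sum_mem _ fun v _ => Submodule.smul_mem _ _ (hW v a ha), ψ, fun w => ?_⟩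
    simp only [P, map_sum, map_smul, ← hadd, Finset.smul_sum, smul_smul, ← AddChar.map_add_eq_mul]
    rw [← Equiv.sum_comp (Equiv.addLeft w) fun v => ψ (w + -v) • τ v a]
    simp
  have hs : ∑ ψ, P ψ = (Fintype.card E : ℂ) • a := by
    simp only [P]
    rw [Finset.sum_comm]
    simp only [← Finset.sum_smul, AddChar.sum_apply_eq_ite, neg_eq_zero]
    simp [ite_smul, h0]
  have hc : (Fintype.card E : ℂ) ≠ 0 := Nat.cast_ne_zero.mpr Fintype.card_ne_zero
  have h : a = (Fintype.card E : ℂ)⁻¹ • ∑ ψ, P ψ := by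
    rw [hs, smul_smul, inv_mul_cancel₀ hc, one_smul]
  rw [h]
  exact Submodule.smul_mem _ _ (Submodule.sum_mem _ fun ψ _ => Submodule.subset_span (hP ψ))

/-- For a group with an elementary abelian `2`-subgroup of order `2 ^ r` and index `m`, every
transfer is a polynomial in the invariants of degree at most `m * (r + 1)`. -/
theorem Representation.actionTransfer_mem_adjoin {G E : Type*} [Group G] [Fintype G]
    [AddCommGroup E] [Fintype E] (hE : ∀ v : E, v + v = 0) {r : ℕ} (hr : Fintype.card E = 2 ^ r)
    (φ : Multiplicative E →* G) {n : ℕ} (ρ : Representation ℂ G (Fin n → ℂ)) (D : ℕ) :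
    ∀ p : MvPolynomial (Fin n) ℂ, p.totalDegree ≤ D → actionTransfer ρ.polyAction p ∈
      Algebra.adjoin ℂ {f : MvPolynomial (Fin n) ℂ | f ∈ ρ.invariantAlgebra ∧
        f.totalDegree ≤ φ.range.index * (r + 1)} := by
  classical
  set B := Algebra.adjoin ℂ {f : MvPolynomial (Fin n) ℂ | f ∈ ρ.invariantAlgebra ∧
    f.totalDegree ≤ φ.range.index * (r + 1)}
  induction D using Nat.strong_induction_on with
  | _ D ih =>
  intro p hp
  rcases le_or_gt D (φ.range.index * (r + 1)) with hD | hD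
  · refine Algebra.subset_adjoin ⟨?_, ?_⟩
    · exact (ρ.mem_invariantAlgebra_iff _).mpr fun g => map_actionTransfer _ g p
    · rw [actionTransfer_apply]
      exact MvPolynomial.totalDegree_finsetSum_le fun g _ =>
        (ρ.totalDegree_polyAction_le g p).trans (hp.trans hD)
  let τ (v : E) : MvPolynomial (Fin n) ℂ →ₐ[ℂ] MvPolynomial (Fin n) ℂ :=
    ρ.polyAction (φ (Multiplicative.ofAdd v))
  have hτ0 : τ 0 = 1 := by simp [τ]
  have hτadd (v w : E) : τ (v + w) = τ v * τ w := by simp [τ]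
  let W := MvPolynomial.restrictTotalDegree (Fin n) ℂ 1
  have hW (q : MvPolynomial (Fin n) ℂ) : q ∈ W ↔ q.totalDegree ≤ 1 :=
    MvPolynomial.mem_restrictTotalDegree _ _ _
  let L : Set (MvPolynomial (Fin n) ℂ) :=
    {x | x ∈ W ∧ ∃ ψ : AddChar E ℂ, ∀ v, τ v x = ψ v • x}
  have hWL (q : MvPolynomial (Fin n) ℂ) (hq : q.totalDegree ≤ 1) : q ∈ Submodule.span ℂ L :=
    mem_span_eigenvectors (fun v => (τ v).toLinearMap) (by ext; simp [hτ0])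
      (fun v w a => by simp [hτadd]) W
      (fun v a ha => (hW _).mpr ((ρ.totalDegree_polyAction_le _ a).trans ((hW a).mp ha)))
      ((hW q).mpr hq)
  have hpL := MvPolynomial.mem_submodule_pow_of_totalDegree_le (Submodule.span ℂ L)
    (hWL 1 (by simp)) (fun i => hWL _ (by simp)) p hp
  rw [Submodule.span_pow] at hpL
  refine (Submodule.span_le (p := B.toSubmodule.comap (actionTransfer ρ.polyAction))).mpr ?_ hpL
  intro x hx
  obtain ⟨l, rfl⟩ := Set.mem_pow.mp hx
  choose ψ hψ using fun i => (l i).2.2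
  let ev (v : E) : AddChar E ℂ →* ℂ :=
    { toFun := fun ψ => ψ v, map_one' := AddChar.one_apply v, map_mul' := fun _ _ => rfl }
  obtain ⟨b, c, e, e', hb, hc, he, hprod⟩ := exists_invariant_factors (Ψ := AddChar E ℂ)
    (fun x => DFunLike.ext _ _ fun v => by
      rw [AddChar.mul_apply, ← AddChar.map_add_eq_mul, hE, AddChar.map_zero_eq_one,
        AddChar.one_apply])
    (by rw [AddChar.card_eq, hr]) τ ev ψ (fun i => (l i : MvPolynomial (Fin n) ℂ))
    (fun i => (hW _).mp (l i).2.1) (fun v i => hψ i v)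
    (Finset.univ : Finset (G ⧸ φ.range)) Finset.univ (by
      rw [Finset.card_univ, Finset.card_univ, Fintype.card_fin, ← Nat.card_eq_fintype_card]
      exact hD.le)
  rw [Finset.card_univ, Fintype.card_fin] at he
  have hlt : ∑ i, e i < D := by
    refine lt_of_le_of_lt (Finset.sum_le_card_nsmul _ _ _ fun i hi => (hb i hi).2.2.2) ?_
    rw [Finset.card_univ, ← Nat.card_eq_fintype_card]
    exact hD
  rw [List.prod_ofFn, hprod]
  refine actionTransfer_mul_prod_mem ρ.polyAction φ.range B b c ?_ ?_ ?_
  · rintro i _ ⟨v, rfl⟩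
    exact (hb i (Finset.mem_univ i)).1 v.toAdd
  · intro S
    refine ih _ hlt _ ((MvPolynomial.totalDegree_finsetProd _ _).trans ?_)
    exact (Finset.sum_le_sum fun i _ => (ρ.totalDegree_polyAction_le _ _).trans
      (hb i (Finset.mem_univ i)).2.1).trans
      (Finset.sum_le_sum_of_subset (Finset.subset_univ S))
  · intro S hS
    obtain ⟨j, hj⟩ : ∃ j, j ∉ S := by
      by_contra! h
      exact hS (Finset.eq_univ_of_forall h)
    have hS' : ∑ i ∈ S, e i < ∑ i, e i :=
      Finset.sum_lt_sum_of_subset (Finset.subset_univ S) (Finset.mem_univ j) hj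
        (hb j (Finset.mem_univ j)).2.2.1 fun _ _ _ => Nat.zero_le _
    refine ih (e' + ∑ i ∈ S, e i) (by omega) _ ?_
    refine (MvPolynomial.totalDegree_mul _ _).trans (add_le_add hc ?_)
    exact (MvPolynomial.totalDegree_finsetProd _ _).trans
      (Finset.sum_le_sum fun i _ => (hb i (Finset.mem_univ i)).2.1)

/-- If `G` has an elementary abelian subgroup of order `2 ^ r` and index `m`, its invariants are
generated in degree at most `m * (r + 1)`. -/
theorem Representation.invariantsGeneratedInDegree_of_elementaryAbelian {G E : Type*} [Group G]
    [Finite G] [AddCommGroup E] [Fintype E] (hE : ∀ v : E, v + v = 0) {r : ℕ}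
    (hr : Fintype.card E = 2 ^ r) (φ : Multiplicative E →* G) {n : ℕ}
    (ρ : Representation ℂ G (Fin n → ℂ)) :
    ρ.InvariantsGeneratedInDegree (φ.range.index * (r + 1)) := by
  have := Fintype.ofFinite G
  refine le_antisymm (Algebra.adjoin_le fun f hf => hf.1) fun f hf => ?_
  have h := ρ.actionTransfer_mem_adjoin hE hr φ f.totalDegree f le_rfl
  rw [actionTransfer_of_invariant _ ((ρ.mem_invariantAlgebra_iff f).mp hf)] at h
  have hc : (Fintype.card G : ℂ) ≠ 0 := Nat.cast_ne_zero.mpr Fintype.card_ne_zero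
  simpa [smul_smul, hc] using Subalgebra.smul_mem _ h (Fintype.card G : ℂ)⁻¹

theorem noetherNumber_pos {G : Type*} [Group G] {d : ℕ}
    (hd : ∀ (n : ℕ) (ρ : Representation ℂ G (Fin n → ℂ)), ρ.InvariantsGeneratedInDegree d) :
    0 < noetherNumber G := by
  refine Nat.pos_of_ne_zero fun h0 => ?_
  have hmem := Nat.sInf_mem (s := {d : ℕ | ∀ (n : ℕ) (ρ : Representation ℂ G (Fin n → ℂ)),
    ρ.InvariantsGeneratedInDegree d}) ⟨d, hd⟩
  change noetherNumber G ∈ _ at hmem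
  rw [h0] at hmem
  have h := hmem 1 1
  have hX : (MvPolynomial.X 0 : MvPolynomial (Fin 1) ℂ) ∈
      (1 : Representation ℂ G (Fin 1 → ℂ)).invariantAlgebra := by
    rw [Representation.mem_invariantAlgebra_iff]
    intro g
    change Representation.polySubst _ _ _ = _
    rw [Representation.polySubst_X]
    simp
  rw [← h] at hX
  have hle : Algebra.adjoin ℂ {f : MvPolynomial (Fin 1) ℂ |
      f ∈ (1 : Representation ℂ G (Fin 1 → ℂ)).invariantAlgebra ∧ f.totalDegree ≤ 0} ≤ ⊥ := by
    refine Algebra.adjoin_le fun f hf => ?_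
    rw [MvPolynomial.totalDegree_eq_zero_iff_eq_C.mp (Nat.le_zero.mp hf.2)]
    exact Subalgebra.algebraMap_mem ⊥ _
  obtain ⟨c, hc⟩ := Algebra.mem_bot.mp (hle hX)
  have := congrArg MvPolynomial.totalDegree hc
  simp [MvPolynomial.algebraMap_eq] at this

theorem le_noetherIndex_of_elementaryAbelian {G E : Type*} [Group G] [Finite G] [AddCommGroup E]
    [Fintype E] (hE : ∀ v : E, v + v = 0) {r : ℕ} (hr : Fintype.card E = 2 ^ r)
    (φ : Multiplicative E →* G) (hφ : Function.Injective φ) :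
    (2 : ℝ) ^ r / (r + 1) ≤ noetherIndex G := by
  have hd (n : ℕ) (ρ : Representation ℂ G (Fin n → ℂ)) :=
    ρ.invariantsGeneratedInDegree_of_elementaryAbelian hE hr φ
  have hle : noetherNumber G ≤ φ.range.index * (r + 1) := Nat.sInf_le hd
  have hpos := noetherNumber_pos hd
  have hcard : 2 ^ r * φ.range.index = Nat.card G := by
    rw [← φ.range.card_mul_index, ← Nat.card_congr (MonoidHom.ofInjective hφ).toEquiv,
      Nat.card_eq_fintype_card, ← hr, Fintype.card_multiplicative]
  rw [noetherIndex, ← hcard, div_le_div_iff₀ (by positivity) (by exact_mod_cast hpos)]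
  push_cast
  rw [mul_assoc]
  gcongr
  exact_mod_cast hle

/-- Translations of `(ℤ/2)²`, applied independently on the blocks of `Fin s × (ℤ/2)²`. -/
def blockTranslation (s : ℕ) : Multiplicative (Fin s → ZMod 2 × ZMod 2) →*
    Equiv.Perm (Fin s × (ZMod 2 × ZMod 2)) where
  toFun v := Equiv.prodCongrRight fun i => Equiv.addLeft (v.toAdd i)
  map_one' := Equiv.ext fun _ => Prod.ext rfl (zero_add _)
  map_mul' _ _ := Equiv.ext fun _ => Prod.ext rfl (add_assoc _ _ _)

theorem blockTranslation_injective (s : ℕ) : Function.Injective (blockTranslation s) := by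
  intro v w h
  refine Multiplicative.toAdd.injective (funext fun i => ?_)
  simpa [blockTranslation] using congrArg Prod.snd (Equiv.congr_fun h (i, 0))

theorem sign_blockTranslation (s : ℕ) (v : Multiplicative (Fin s → ZMod 2 × ZMod 2)) :
    Equiv.Perm.sign (blockTranslation s v) = 1 := by
  have h : ∀ x : ZMod 2 × ZMod 2, Equiv.Perm.sign (Equiv.addLeft x) = 1 := by decide
  exact (Equiv.Perm.sign_prodCongrRight _).trans (Finset.prod_eq_one fun i _ => h _)

theorem exists_blockTranslation_alternatingGroup {k s : ℕ} (h : 4 * s ≤ k) :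
    ∃ φ : Multiplicative (Fin s → ZMod 2 × ZMod 2) →* alternatingGroup (Fin k),
      Function.Injective φ := by
  obtain ⟨f⟩ : Nonempty (Fin s × (ZMod 2 × ZMod 2) ↪ Fin k) :=
    Function.Embedding.nonempty_of_card_le (by simpa [mul_comm] using h)
  let θ := (Equiv.Perm.extendDomainHom (Equiv.ofInjective f f.injective)).comp (blockTranslation s)
  refine ⟨θ.codRestrict _ fun v => ?_, ?_⟩
  · rw [Equiv.Perm.mem_alternatingGroup]
    exact (Equiv.Perm.sign_extendDomain _ _).trans (sign_blockTranslation s v)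
  · exact (MonoidHom.injective_codRestrict _ _ _).mpr
      ((Equiv.Perm.extendDomainHom_injective _).comp (blockTranslation_injective s))

theorem two_rpow_lt_of_eq_div_four {k s : ℕ} (hk : 11 ≤ k) (hs : s = k / 4) :
    (2 : ℝ) ^ ((k : ℝ) / 10) < (2 : ℝ) ^ (2 * s) / (2 * s + 1) := by
  have h2 : 2 ≤ s := by omega
  have hk' : (k : ℝ) ≤ 4 * s + 3 := by exact_mod_cast (by omega : k ≤ 4 * s + 3)
  have hsq : (2 * s + 1) ^ 2 < 2 ^ (2 * s + 1) := by
    clear hs hk'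
    induction s, h2 using Nat.le_induction with
    | base => norm_num
    | succ t ht ih =>
      rw [show 2 * (t + 1) + 1 = 2 * t + 1 + 2 by ring, pow_add 2 (2 * t + 1) 2]
      nlinarith
  have hlt : (2 * s + 1 : ℝ) < 2 ^ ((2 * s + 1 : ℝ) / 2) := by
    refine lt_of_pow_lt_pow_left₀ 2 (by positivity) ?_
    rw [← Real.rpow_mul_natCast (by norm_num)]
    norm_num
    exact_mod_cast hsq
  rw [lt_div_iff₀ (by positivity)]
  calc (2 : ℝ) ^ ((k : ℝ) / 10) * (2 * s + 1)
      < 2 ^ ((k : ℝ) / 10) * 2 ^ ((2 * s + 1 : ℝ) / 2) := by gcongr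
    _ = 2 ^ ((k : ℝ) / 10 + (2 * s + 1 : ℝ) / 2) := (Real.rpow_add (by norm_num) _ _).symm
    _ ≤ 2 ^ ((2 * s : ℕ) : ℝ) := by
      refine Real.rpow_le_rpow_of_exponent_le (by norm_num) ?_
      have : (2 : ℝ) ≤ s := by exact_mod_cast h2
      push_cast
      linarith
    _ = 2 ^ (2 * s) := Real.rpow_natCast _ _

/-- **Bound for alternating groups.**  For `k ≥ 11` and `s = ⌊k/4⌋` we have
`n(A_k) ≥ 2^(2s)/(2s+1)`, and consequently `n(A_k) > 2^(k/10)`. -/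
theorem noetherIndex_alternatingGroup
    (k : ℕ) (hk : 11 ≤ k) (s : ℕ) (hs : s = k / 4) :
    (2 : ℝ) ^ (2 * s) / (2 * s + 1) ≤ noetherIndex (alternatingGroup (Fin k)) ∧
    (2 : ℝ) ^ ((k : ℝ) / 10) < noetherIndex (alternatingGroup (Fin k)) := by
  obtain ⟨φ, hφ⟩ := exists_blockTranslation_alternatingGroup (k := k) (s := s) (by omega)
  have h := le_noetherIndex_of_elementaryAbelian (r := 2 * s)
    (fun v => funext fun i => by
      have h2 : ∀ x : ZMod 2 × ZMod 2, x + x = 0 := by decide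
      exact h2 (v i))
    (by simp [pow_mul]) φ hφ
  push_cast at h
  exact ⟨h, (two_rpow_lt_of_eq_div_four hk hs).trans_le h⟩
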